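/- Fix x ∈ ℝ^N and n ∈ ℝ^M, and for an M×N real matrix H write y(H) = Hx + n. For indices k ∈ K, l ∈ L, the map H ↦ f^{kl}(y(H)), where f^{kl} is the Gaussian density with mean u_y^{kl}(H) = H u_x^k + u_n^l and covariance C_yy^{kl}(H) = H C_x^k Hᵀ + C_n^l evaluated at y(H), is differentiable with gradient −f^{kl}(y(H)) · R^{kl}(H), where, writing w^{kl} = y(H) − u_y^{kl}(H), R^{kl}(H) = (C_yy^{kl})^{−1} w^{kl} (x − u_x^k)ᵀ + (C_yy^{kl})^{−1} (I_M − w^{kl} (w^{kl})ᵀ (C_yy^{kl})^{−1}) H C_x^k. -/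

import Mathlib

open Matrix

attribute [local instance] Matrix.normedAddCommGroup Matrix.normedSpace

/-- The Gaussian density `N(u, C)` evaluated at `t`:
`(2π)^(−M/2) det(C)^(−1/2) exp(−(1/2)(t−u)ᵀ C⁻¹ (t−u))`. -/
noncomputable def gaussianPdf {M : ℕ} (u : Fin M → ℝ)
    (C : Matrix (Fin M) (Fin M) ℝ) (t : Fin M → ℝ) : ℝ :=
  (2 * Real.pi) ^ (-(M : ℝ) / 2) * C.det ^ (-(1 : ℝ) / 2) *
    Real.exp (-(1 / 2) * ((t - u) ⬝ᵥ C⁻¹ *ᵥ (t - u)))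

/-- `Cyy(H) = H Cx Hᵀ + Cn`. -/
def Cyy {M N : ℕ} (Cx : Matrix (Fin N) (Fin N) ℝ) (Cn : Matrix (Fin M) (Fin M) ℝ)
    (H : Matrix (Fin M) (Fin N) ℝ) : Matrix (Fin M) (Fin M) ℝ :=
  H * Cx * Hᵀ + Cn

/-- `w(H) = y(H) − u_y(H) = (H x + n) − (H ux + un)`. -/
def wVec {M N : ℕ} (ux : Fin N → ℝ) (un : Fin M → ℝ)
    (H : Matrix (Fin M) (Fin N) ℝ) (x : Fin N → ℝ) (n : Fin M → ℝ) : Fin M → ℝ :=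
  (H *ᵥ x + n) - (H *ᵥ ux + un)

/-- The matrix `R(H) = Cyy⁻¹ w (x − ux)ᵀ + Cyy⁻¹ (I − w wᵀ Cyy⁻¹) H Cx`. -/
noncomputable def Rmat {M N : ℕ} (ux : Fin N → ℝ) (Cx : Matrix (Fin N) (Fin N) ℝ)
    (un : Fin M → ℝ) (Cn : Matrix (Fin M) (Fin M) ℝ)
    (H : Matrix (Fin M) (Fin N) ℝ) (x : Fin N → ℝ) (n : Fin M → ℝ) :
    Matrix (Fin M) (Fin N) ℝ :=
  vecMulVec ((Cyy Cx Cn H)⁻¹ *ᵥ wVec ux un H x n) (x - ux) +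
    (Cyy Cx Cn H)⁻¹ *
      (1 - vecMulVec (wVec ux un H x n) (wVec ux un H x n) * (Cyy Cx Cn H)⁻¹) * (H * Cx)

namespace Matrix

variable {E : Type*} [NormedAddCommGroup E] [NormedSpace ℝ E]
  {l m n : Type*} [Fintype n]

theorem differentiableAt_det [DecidableEq n] {A : E → Matrix n n ℝ} {x : E}
    (hA : ∀ i j, DifferentiableAt ℝ (fun y => A y i j) x) :
    DifferentiableAt ℝ (fun y => (A y).det) x := by
  simp only [det_apply]
  fun_prop

theorem differentiableAt_inv_apply [DecidableEq n] {A : E → Matrix n n ℝ} {x : E}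
    (hA : ∀ i j, DifferentiableAt ℝ (fun y => A y i j) x) (h : (A x).det ≠ 0) (i j : n) :
    DifferentiableAt ℝ (fun y => (A y)⁻¹ i j) x := by
  simp only [inv_def, Ring.inverse_eq_inv', smul_apply, smul_eq_mul, adjugate_apply]
  refine ((differentiableAt_det hA).inv h).mul (differentiableAt_det fun k l => ?_)
  by_cases hk : k = j
  · subst hk
    simp
  · simpa [updateRow_ne hk] using hA k l

theorem hasDerivAt_mul_apply {A : ℝ → Matrix l n ℝ} {B : ℝ → Matrix n m ℝ}
    {A' : Matrix l n ℝ} {B' : Matrix n m ℝ} {t : ℝ}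
    (hA : ∀ i j, HasDerivAt (fun s => A s i j) (A' i j) t)
    (hB : ∀ i j, HasDerivAt (fun s => B s i j) (B' i j) t) (i : l) (j : m) :
    HasDerivAt (fun s => (A s * B s) i j) ((A' * B t + A t * B') i j) t := by
  simp only [add_apply, mul_apply, ← Finset.sum_add_distrib]
  exact HasDerivAt.fun_sum fun k _ => (hA i k).mul (hB k j)

theorem hasDerivAt_mulVec_apply {A : ℝ → Matrix m n ℝ} {v : ℝ → n → ℝ}
    {A' : Matrix m n ℝ} {v' : n → ℝ} {t : ℝ}
    (hA : ∀ i j, HasDerivAt (fun s => A s i j) (A' i j) t)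
    (hv : ∀ j, HasDerivAt (fun s => v s j) (v' j) t) (i : m) :
    HasDerivAt (fun s => (A s *ᵥ v s) i) ((A' *ᵥ v t + A t *ᵥ v') i) t := by
  simp only [Pi.add_apply, mulVec, dotProduct, ← Finset.sum_add_distrib]
  exact HasDerivAt.fun_sum fun k _ => (hA i k).mul (hv k)

theorem hasDerivAt_dotProduct {v w : ℝ → n → ℝ} {v' w' : n → ℝ} {t : ℝ}
    (hv : ∀ j, HasDerivAt (fun s => v s j) (v' j) t)
    (hw : ∀ j, HasDerivAt (fun s => w s j) (w' j) t) :
    HasDerivAt (fun s => v s ⬝ᵥ w s) (v' ⬝ᵥ w t + v t ⬝ᵥ w') t := by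
  simp only [dotProduct, ← Finset.sum_add_distrib]
  exact HasDerivAt.fun_sum fun k _ => (hv k).mul (hw k)

/-- Jacobi's formula. -/
theorem hasDerivAt_det [DecidableEq n] {A : ℝ → Matrix n n ℝ} {A' : Matrix n n ℝ} {t : ℝ}
    (hA : ∀ i j, HasDerivAt (fun s => A s i j) (A' i j) t) :
    HasDerivAt (fun s => (A s).det) ((A t).adjugate * A').trace t := by
  let d : ContinuousMultilinearMap ℝ (fun _ : n => n → ℝ) ℝ :=
    ⟨(detRowAlternating (n := n) (R := ℝ)).toMultilinearMap,
      Continuous.matrix_det (A := fun M : n → n → ℝ => (of M : Matrix n n ℝ)) continuous_id⟩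
  have hrow : HasDerivAt (fun s i j => A s i j) (fun i j => A' i j) t :=
    hasDerivAt_pi.2 fun i => hasDerivAt_pi.2 fun j => hA i j
  have h := (d.hasFDerivAt (x := fun i j => A t i j)).comp_hasDerivAt t hrow
  have hd : d.linearDeriv (fun i j => A t i j) (fun i j => A' i j) =
      ((A t).adjugate * A').trace := by
    rw [ContinuousMultilinearMap.linearDeriv_apply, trace_mul_comm, trace]
    refine Finset.sum_congr rfl fun i _ => ?_
    change ((A t).updateRow i (A' i)).det = _
    rw [← cramer_transpose_apply, cramer_eq_adjugate_mulVec, ← adjugate_transpose]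
    simp [mulVec, dotProduct, mul_apply, mul_comm]
  rw [hd] at h
  exact h

theorem hasDerivAt_inv_apply [DecidableEq n] {A : ℝ → Matrix n n ℝ} {A' : Matrix n n ℝ} {t : ℝ}
    (hA : ∀ i j, HasDerivAt (fun s => A s i j) (A' i j) t) (h : (A t).det ≠ 0) (i j : n) :
    HasDerivAt (fun s => (A s)⁻¹ i j) ((-((A t)⁻¹ * A' * (A t)⁻¹)) i j) t := by
  let B' : Matrix n n ℝ := of fun i j => deriv (fun s => (A s)⁻¹ i j) t
  have hB : ∀ i j, HasDerivAt (fun s => (A s)⁻¹ i j) (B' i j) t := fun i j =>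
    (differentiableAt_inv_apply (fun i j => (hA i j).differentiableAt) h i j).hasDerivAt
  have hne : ∀ᶠ s in nhds t, (A s).det ≠ 0 :=
    (hasDerivAt_det hA).continuousAt.eventually_ne h
  have hzero : A' * (A t)⁻¹ + A t * B' = 0 := by
    ext i j
    refine (hasDerivAt_mul_apply hA hB i j).unique
      ((hasDerivAt_const t ((1 : Matrix n n ℝ) i j)).congr_of_eventuallyEq ?_)
    filter_upwards [hne] with s hs
    rw [mul_nonsing_inv _ hs.isUnit]
  have hB' : B' = -((A t)⁻¹ * A' * (A t)⁻¹) := by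
    rw [← nonsing_inv_mul_cancel_left (A t) B' h.isUnit, eq_neg_of_add_eq_zero_right hzero,
      mul_neg, Matrix.mul_assoc]
  exact hB' ▸ hB i j

end Matrix

section GaussianPath

variable {M N : ℕ} (ux : Fin N → ℝ) (Cx : Matrix (Fin N) (Fin N) ℝ)
  (un : Fin M → ℝ) (Cn : Matrix (Fin M) (Fin M) ℝ) (x : Fin N → ℝ) (n : Fin M → ℝ)

theorem posDef_Cyy {Cx : Matrix (Fin N) (Fin N) ℝ} {Cn : Matrix (Fin M) (Fin M) ℝ}
    (hCx : Cx.PosSemidef) (hCn : Cn.PosDef) (H : Matrix (Fin M) (Fin N) ℝ) :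
    (Cyy Cx Cn H).PosDef := by
  have h := hCx.mul_mul_conjTranspose_same H
  rw [conjTranspose_eq_transpose_of_trivial] at h
  exact PosDef.posSemidef_add h hCn

theorem differentiableAt_matrix_apply (H : Matrix (Fin M) (Fin N) ℝ) (i : Fin M) (j : Fin N) :
    DifferentiableAt ℝ (fun H' : Matrix (Fin M) (Fin N) ℝ => H' i j) H :=
  (LinearMap.toContinuousLinearMap (Matrix.entryLinearMap ℝ ℝ i j)).differentiableAt

theorem differentiableAt_gaussianPdf_path {Cx : Matrix (Fin N) (Fin N) ℝ}
    {Cn : Matrix (Fin M) (Fin M) ℝ} {H : Matrix (Fin M) (Fin N) ℝ}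
    (hC : (Cyy Cx Cn H).det ≠ 0) :
    DifferentiableAt ℝ (fun H' : Matrix (Fin M) (Fin N) ℝ =>
      gaussianPdf (H' *ᵥ ux + un) (Cyy Cx Cn H') (H' *ᵥ x + n)) H := by
  have hH := differentiableAt_matrix_apply H
  have hCyy : ∀ i j, DifferentiableAt ℝ (fun H' => Cyy Cx Cn H' i j) H := fun i j => by
    simp only [Cyy, Matrix.add_apply, mul_apply, transpose_apply]
    fun_prop
  have hdet := differentiableAt_det hCyy
  have hinv := differentiableAt_inv_apply hCyy hC
  have hw : ∀ i, DifferentiableAt ℝ (fun H' => wVec ux un H' x n i) H := fun i => by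
    simp only [wVec, mulVec, dotProduct, Pi.sub_apply, Pi.add_apply]
    fun_prop
  have hq : DifferentiableAt ℝ
      (fun H' => wVec ux un H' x n ⬝ᵥ (Cyy Cx Cn H')⁻¹ *ᵥ wVec ux un H' x n) H := by
    simp only [mulVec, dotProduct]
    exact DifferentiableAt.fun_sum fun i _ => (hw i).mul
      (DifferentiableAt.fun_sum fun j _ => (hinv i j).mul (hw j))
  exact ((hdet.rpow_const (Or.inl hC)).const_mul _).mul (hq.const_mul _).exp

theorem trace_Rmat_transpose_mul {H : Matrix (Fin M) (Fin N) ℝ} (hCx : Cxᵀ = Cx)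
    (hC : (Cyy Cx Cn H)⁻¹ᵀ = (Cyy Cx Cn H)⁻¹) (Δ : Matrix (Fin M) (Fin N) ℝ) :
    2 * ((Rmat ux Cx un Cn H x n)ᵀ * Δ).trace =
      ((Cyy Cx Cn H)⁻¹ * (Δ * Cx * Hᵀ + H * Cx * Δᵀ)).trace +
        ((Δ *ᵥ (x - ux)) ⬝ᵥ (Cyy Cx Cn H)⁻¹ *ᵥ wVec ux un H x n +
          wVec ux un H x n ⬝ᵥ
            (-((Cyy Cx Cn H)⁻¹ * (Δ * Cx * Hᵀ + H * Cx * Δᵀ) * (Cyy Cx Cn H)⁻¹) *ᵥ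
                wVec ux un H x n + (Cyy Cx Cn H)⁻¹ *ᵥ (Δ *ᵥ (x - ux)))) := by
  unfold Rmat
  generalize (Cyy Cx Cn H)⁻¹ = P at *
  generalize wVec ux un H x n = w
  generalize x - ux = v
  have hw : w ᵥ* P = P *ᵥ w := by rw [← mulVec_transpose, hC]
  have htrace : (P * (H * Cx * Δᵀ)).trace = (P * (Δ * Cx * Hᵀ)).trace := by
    rw [← trace_transpose]
    simp only [transpose_mul, transpose_transpose, hC, hCx]
    rw [trace_mul_comm, Matrix.mul_assoc]
  have hquad : (P *ᵥ w) ⬝ᵥ (H * Cx * Δᵀ) *ᵥ (P *ᵥ w) =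
      (P *ᵥ w) ⬝ᵥ (Δ * Cx * Hᵀ) *ᵥ (P *ᵥ w) := by
    rw [dotProduct_mulVec, ← mulVec_transpose, dotProduct_comm]
    simp only [transpose_mul, transpose_transpose, hCx, Matrix.mul_assoc]
  have hR : ((vecMulVec (P *ᵥ w) v + P * (1 - vecMulVec w w * P) * (H * Cx))ᵀ * Δ).trace =
      (P *ᵥ w) ⬝ᵥ Δ *ᵥ v + (P * (Δ * Cx * Hᵀ)).trace -
        (P *ᵥ w) ⬝ᵥ (Δ * Cx * Hᵀ) *ᵥ (P *ᵥ w) := by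
    have h1 : ((vecMulVec (P *ᵥ w) v)ᵀ * Δ).trace = (P *ᵥ w) ⬝ᵥ Δ *ᵥ v := by
      rw [transpose_vecMulVec, trace_mul_comm, mul_vecMulVec, trace_vecMulVec, dotProduct_comm]
    have h2 : ((P * (H * Cx))ᵀ * Δ).trace = (P * (Δ * Cx * Hᵀ)).trace := by
      rw [transpose_mul, transpose_mul, hC, hCx, Matrix.mul_assoc, trace_mul_comm,
        ← Matrix.mul_assoc, ← Matrix.mul_assoc, ← Matrix.mul_assoc]
    have h3 : ((vecMulVec (P *ᵥ w) (P *ᵥ w) * (H * Cx))ᵀ * Δ).trace =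
        (P *ᵥ w) ⬝ᵥ (Δ * Cx * Hᵀ) *ᵥ (P *ᵥ w) := by
      rw [transpose_mul, transpose_vecMulVec, transpose_mul, hCx, Matrix.mul_assoc,
        trace_mul_comm, Matrix.mul_assoc, vecMulVec_mul, trace_vecMulVec, dotProduct_comm,
        ← dotProduct_mulVec, Matrix.mul_assoc]
    have h4 : P * (1 - vecMulVec w w * P) * (H * Cx) =
        P * (H * Cx) - vecMulVec (P *ᵥ w) (P *ᵥ w) * (H * Cx) := by
      rw [Matrix.mul_sub, Matrix.mul_one, vecMulVec_mul, hw, mul_vecMulVec, Matrix.sub_mul]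
    rw [h4, transpose_add, transpose_sub, Matrix.add_mul, Matrix.sub_mul, trace_add, trace_sub,
      h1, h2, h3]
    ring
  have hPw : ∀ u, w ⬝ᵥ P *ᵥ u = (P *ᵥ w) ⬝ᵥ u := fun u => by rw [dotProduct_mulVec, hw]
  rw [hR, Matrix.mul_add, trace_add, htrace, dotProduct_add, hPw, neg_mulVec, dotProduct_neg,
    ← Matrix.mul_add, ← mulVec_mulVec w _ P, ← mulVec_mulVec _ P, hPw, add_mulVec, dotProduct_add, hquad,
    dotProduct_comm (Δ *ᵥ v)]
  ring

theorem hasDerivAt_gaussianPdf_line {Cx : Matrix (Fin N) (Fin N) ℝ}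
    {Cn : Matrix (Fin M) (Fin M) ℝ} (hCx : Cx.PosSemidef) (hCn : Cn.PosDef)
    (H Δ : Matrix (Fin M) (Fin N) ℝ) :
    HasDerivAt (fun t : ℝ => gaussianPdf ((H + t • Δ) *ᵥ ux + un) (Cyy Cx Cn (H + t • Δ))
        ((H + t • Δ) *ᵥ x + n))
      (-gaussianPdf (H *ᵥ ux + un) (Cyy Cx Cn H) (H *ᵥ x + n) *
        ((Rmat ux Cx un Cn H x n)ᵀ * Δ).trace) 0 := by
  have hpd := posDef_Cyy hCx hCn H
  have hdet0 : 0 < (Cyy Cx Cn H).det := hpd.det_pos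
  have hCxT : Cxᵀ = Cx := by
    simpa [conjTranspose_eq_transpose_of_trivial] using hCx.isHermitian.eq
  have hPT : (Cyy Cx Cn H)⁻¹ᵀ = (Cyy Cx Cn H)⁻¹ := by
    simpa [conjTranspose_eq_transpose_of_trivial] using hpd.inv.isHermitian.eq
  have hline : H + (0 : ℝ) • Δ = H := by simp
  have hH : ∀ i j, HasDerivAt (fun t : ℝ => (H + t • Δ) i j) (Δ i j) 0 := fun i j => by
    simpa using ((hasDerivAt_id (0 : ℝ)).mul_const (Δ i j)).const_add (H i j)
  have hconst : ∀ {k l : ℕ} (A : Matrix (Fin k) (Fin l) ℝ) i j,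
      HasDerivAt (fun _ : ℝ => A i j) ((0 : Matrix (Fin k) (Fin l) ℝ) i j) 0 :=
    fun A i j => hasDerivAt_const _ _
  have hCyy : ∀ i j, HasDerivAt (fun t : ℝ => Cyy Cx Cn (H + t • Δ) i j)
      ((Δ * Cx * Hᵀ + H * Cx * Δᵀ) i j) 0 := fun i j => by
    have h := (hasDerivAt_mul_apply (hasDerivAt_mul_apply hH (hconst Cx))
      (B := fun t => (H + t • Δ)ᵀ) (B' := Δᵀ) (fun i j => hH j i) i j).add_const (Cn i j)
    simp only [hline, Matrix.mul_zero, add_zero] at h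
    exact h
  have hw : ∀ i, HasDerivAt
      (fun t : ℝ => ((H + t • Δ) *ᵥ x + n - ((H + t • Δ) *ᵥ ux + un)) i)
      ((Δ *ᵥ (x - ux)) i) 0 := fun i => by
    have hm : ∀ v : Fin N → ℝ,
        HasDerivAt (fun t : ℝ => ((H + t • Δ) *ᵥ v) i) ((Δ *ᵥ v) i) 0 := fun v => by
      simpa using hasDerivAt_mulVec_apply hH (v' := 0) (fun j => hasDerivAt_const _ (v j)) i
    rw [mulVec_sub]
    exact ((hm x).add_const (n i)).sub ((hm ux).add_const (un i))
  have hdet := hasDerivAt_det hCyy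
  have hinv := hasDerivAt_inv_apply hCyy (by simpa only [hline] using hdet0.ne')
  have hq := hasDerivAt_dotProduct hw (hasDerivAt_mulVec_apply hinv hw)
  have hf := ((hdet.rpow_const (p := -(1 : ℝ) / 2)
    (Or.inl (by simpa only [hline] using hdet0.ne'))).const_mul
      ((2 * Real.pi) ^ (-(M : ℝ) / 2))).mul (hq.const_mul (-(1 / 2))).exp
  simp only [hline] at hf
  have hadj : (Cyy Cx Cn H).adjugate = (Cyy Cx Cn H).det • (Cyy Cx Cn H)⁻¹ := by
    rw [inv_def, Ring.inverse_eq_inv', smul_smul, mul_inv_cancel₀ hdet0.ne', one_smul]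
  have hR := trace_Rmat_transpose_mul ux Cx un Cn x n hCxT hPT Δ
  refine hf.congr_deriv ?_
  rw [show ((Rmat ux Cx un Cn H x n)ᵀ * Δ).trace =
    1 / 2 * (2 * ((Rmat ux Cx un Cn H x n)ᵀ * Δ).trace) by ring, hR, hadj, Matrix.smul_mul,
    trace_smul, smul_eq_mul, Real.rpow_sub_one hdet0.ne']
  simp only [gaussianPdf, wVec]
  field_simp
  ring

end GaussianPath

/-- For fixed `x, n`, the map `H ↦ f^{kl}(y(H))` (the Gaussian density with
mean `H ux + un` and covariance `H Cx Hᵀ + Cn`, evaluated at `y(H) = H x + n`) is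
differentiable with gradient `−f^{kl}(y(H)) · R(H)`. -/
theorem hasGradient_gaussianPdf_along_path
    {M N : ℕ} (ux : Fin N → ℝ) (Cx : Matrix (Fin N) (Fin N) ℝ)
    (un : Fin M → ℝ) (Cn : Matrix (Fin M) (Fin M) ℝ)
    (hCx : Cx.PosSemidef) (hCn : Cn.PosDef)
    (x : Fin N → ℝ) (n : Fin M → ℝ) (H : Matrix (Fin M) (Fin N) ℝ) :
    ∃ L : Matrix (Fin M) (Fin N) ℝ →L[ℝ] ℝ,
      HasFDerivAt
        (fun H' : Matrix (Fin M) (Fin N) ℝ =>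
          gaussianPdf (H' *ᵥ ux + un) (Cyy Cx Cn H') (H' *ᵥ x + n)) L H ∧
      ∀ Δ : Matrix (Fin M) (Fin N) ℝ,
        L Δ = (((-gaussianPdf (H *ᵥ ux + un) (Cyy Cx Cn H) (H *ᵥ x + n)) •
            Rmat ux Cx un Cn H x n)ᵀ * Δ).trace := by
  have hdiff := differentiableAt_gaussianPdf_path ux un x n (posDef_Cyy hCx hCn H).det_pos.ne'
  refine ⟨_, hdiff.hasFDerivAt, fun Δ => ?_⟩
  rw [transpose_smul, Matrix.smul_mul, trace_smul, smul_eq_mul]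
  exact (hdiff.hasFDerivAt.hasLineDerivAt Δ).unique
    (hasDerivAt_gaussianPdf_line ux un x n hCx hCn H Δ)
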